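/- Let p ∈ ℂ^n and let D be a real-analytic function on a neighborhood of p which is in Bochner form at p. Then the function det[∂²D/∂z_a ∂z̄_b]_{a,b=1,…,n} is of diastasis-type at p, i.e. its power series expansion at p contains no nonconstant purely holomorphic and no nonconstant purely antiholomorphic monomials. -/

import Mathlib

open Filter Topology Complex

/-- Wirtinger derivative `∂F/∂z_j = ½(∂F/∂x_j − i ∂F/∂y_j)`. -/
noncomputable def wderiv {n : ℕ} (j : Fin n) (F : (Fin n → ℂ) → ℂ) (z : Fin n → ℂ) : ℂ :=
  (1 / 2 : ℂ) * (fderiv ℝ F z (Pi.single j 1) - Complex.I * fderiv ℝ F z (Pi.single j Complex.I))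

/-- Conjugate Wirtinger derivative `∂F/∂z̄_j = ½(∂F/∂x_j + i ∂F/∂y_j)`. -/
noncomputable def wderivBar {n : ℕ} (j : Fin n) (F : (Fin n → ℂ) → ℂ) (z : Fin n → ℂ) : ℂ :=
  (1 / 2 : ℂ) * (fderiv ℝ F z (Pi.single j 1) + Complex.I * fderiv ℝ F z (Pi.single j Complex.I))

/-- Bochner form at `p` (expansion `|z−p|² + Σ_{|j|≥2,|k|≥2} b_{jk}(z−p)^j (z̄−p̄)^k`),
encoded through the holomorphic extension `E(z,w)` with `D(z) = E(z, z̄)`. -/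
def IsBochnerAt {n : ℕ} (D : (Fin n → ℂ) → ℂ) (p : Fin n → ℂ) : Prop :=
  ∃ (E : (Fin n → ℂ) → (Fin n → ℂ) → ℂ) (U V : Set (Fin n → ℂ)),
    IsOpen U ∧ IsOpen V ∧ p ∈ U ∧ star p ∈ V ∧
    DifferentiableOn ℂ (fun zw : (Fin n → ℂ) × (Fin n → ℂ) => E zw.1 zw.2) (U ×ˢ V) ∧
    (∀ᶠ z in 𝓝 p, D z = E z (star z)) ∧
    (let R : (Fin n → ℂ) → (Fin n → ℂ) → ℂ := fun z w =>
       E z w - ∑ j : Fin n, (z j - p j) * (w j - (starRingEnd ℂ) (p j))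
     (∀ w ∈ V, R p w = 0 ∧ fderiv ℂ (fun z => R z w) p = 0) ∧
     (∀ z ∈ U, R z (star p) = 0 ∧ fderiv ℂ (fun w => R z w) (star p) = 0))

/-- A real-analytic function `g` is of diastasis-type at `p` if its expansion in
`(z−p)` and `(z̄−p̄)` has no nonconstant purely holomorphic or purely antiholomorphic
monomials; encoded through the holomorphic extension `E(z,w)` with `g(z) = E(z, z̄)`:
`E(·, p̄)` and `E(p, ·)` are constant. -/
def IsDiastasisTypeAt {n : ℕ} (g : (Fin n → ℂ) → ℂ) (p : Fin n → ℂ) : Prop :=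
  ∃ (E : (Fin n → ℂ) → (Fin n → ℂ) → ℂ) (U V : Set (Fin n → ℂ)),
    IsOpen U ∧ IsOpen V ∧ p ∈ U ∧ star p ∈ V ∧
    DifferentiableOn ℂ (fun zw : (Fin n → ℂ) × (Fin n → ℂ) => E zw.1 zw.2) (U ×ˢ V) ∧
    (∀ᶠ z in 𝓝 p, g z = E z (star z)) ∧
    (∀ z ∈ U, E z (star p) = E p (star p)) ∧
    (∀ w ∈ V, E p w = E p (star p))

/-- A directional derivative of a holomorphic function on an open subset of a finite-dimensional
complex vector space is holomorphic. -/
theorem holomorphic_differentiableAt_fderiv_apply {E : Type*} [NormedAddCommGroup E]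
    [NormedSpace ℂ E] [FiniteDimensional ℂ E] {F : E → ℂ} {S : Set E} (hS : IsOpen S)
    (hF : DifferentiableOn ℂ F S) {x₀ : E} (hx₀ : x₀ ∈ S) (v : E) :
    DifferentiableAt ℂ (fun x => fderiv ℂ F x v) x₀ := by
  obtain ⟨ε, hε, hball⟩ : ∃ ε > 0, ∀ y ∈ Metric.ball x₀ ε, y ∈ S ∧ ‖F y - F x₀‖ < 1 := by
    refine Metric.eventually_nhds_iff_ball.1 (Filter.Eventually.and (hS.mem_nhds hx₀) ?_)
    have := (hF.differentiableAt (hS.mem_nhds hx₀)).continuousAt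
    have := Metric.continuousAt_iff'.1 this 1 one_pos
    simpa [dist_eq_norm] using this
  have hdiff : ∀ y ∈ Metric.ball x₀ ε, DifferentiableAt ℂ F y := fun y hy =>
    hF.differentiableAt (hS.mem_nhds (hball y hy).1)
  have hbound : ∀ y ∈ Metric.ball x₀ (ε / 2), ‖fderiv ℂ F y‖ ≤ 2 / (ε / 2) := by
    intro y hy
    have hsub : Metric.ball y (ε / 2) ⊆ Metric.ball x₀ ε :=
      Metric.ball_subset_ball' (by rw [Metric.mem_ball] at hy; linarith)
    refine norm_fderiv_le_div_of_mapsTo_ball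
      (fun z hz => (hdiff z (hsub hz)).differentiableWithinAt) (fun z hz => ?_) (half_pos hε)
    rw [Metric.mem_closedBall, dist_eq_norm]
    have h1 := (hball z (hsub hz)).2
    have h2 := (hball y (Metric.ball_subset_ball (by linarith) hy)).2
    calc ‖F z - F y‖ = ‖(F z - F x₀) - (F y - F x₀)‖ := by ring_nf
      _ ≤ 2 := by linarith [norm_sub_le (F z - F x₀) (F y - F x₀)]
  obtain ⟨r, hr, hrv⟩ : ∃ r > 0, r * ‖v‖ < ε / 4 := by
    refine ⟨ε / 4 / (‖v‖ + 1), by positivity, ?_⟩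
    rw [div_mul_eq_mul_div, div_lt_iff₀ (by positivity)]
    nlinarith
  have hmem : ∀ x ∈ Metric.ball x₀ (ε / 4), ∀ c ∈ Metric.closedBall (0 : ℂ) r,
      x + c • v ∈ Metric.ball x₀ (ε / 2) := by
    intro x hx c hc
    rw [Metric.mem_ball, dist_eq_norm] at *
    rw [mem_closedBall_zero_iff] at hc
    calc ‖x + c • v - x₀‖ = ‖(x - x₀) + c • v‖ := by congr 1; abel
      _ ≤ ‖x - x₀‖ + ‖c‖ * ‖v‖ := by rw [← norm_smul]; exact norm_add_le _ _
      _ < ε / 2 := by nlinarith [norm_nonneg v]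
  have hcm : ∀ t, circleMap (0 : ℂ) r t ∈ Metric.closedBall (0 : ℂ) r := fun t =>
    circleMap_mem_closedBall 0 hr.le t
  have hlarge : Metric.ball x₀ (ε / 2) ⊆ Metric.ball x₀ ε :=
    Metric.ball_subset_ball (by linarith)
  have hcauchy : ∀ x ∈ Metric.ball x₀ (ε / 4),
      cderiv r (fun c : ℂ => F (x + c • v)) 0 = fderiv ℂ F x v := by
    intro x hx
    have hline : ∀ c : ℂ, HasDerivAt (fun c : ℂ => x + c • v) v c := fun c => by
      simpa using ((hasDerivAt_id c).smul_const v).const_add x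
    have hopen : IsOpen ((fun c : ℂ => x + c • v) ⁻¹' Metric.ball x₀ (ε / 2)) :=
      Metric.isOpen_ball.preimage (by fun_prop)
    rw [cderiv_eq_deriv hopen (fun c hc => ?_) hr (fun c hc => hmem x hx c hc)]
    · have h0 : x ∈ Metric.ball x₀ ε := Metric.ball_subset_ball (by linarith) hx
      have h1 : HasFDerivAt F (fderiv ℂ F x) (x + (0 : ℂ) • v) := by
        simpa using (hdiff x h0).hasFDerivAt
      exact (h1.comp_hasDerivAt (0 : ℂ) (hline 0)).deriv
    · exact ((hdiff _ (hlarge hc)).comp c (hline c).differentiableAt).differentiableWithinAt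
  set k : ℝ → ℂ := fun t => deriv (circleMap 0 r) t * ((circleMap 0 r t - 0) ^ 2)⁻¹ with hk
  have hk_cont : Continuous k := by
    have : ∀ t, (circleMap 0 r t - 0) ^ 2 ≠ 0 := fun t => by
      simpa using hr.ne'
    simp only [hk, deriv_circleMap]
    fun_prop (disch := exact this _)
  have hF_cont : ∀ x ∈ Metric.ball x₀ (ε / 4),
      Continuous fun t : ℝ => k t • F (x + circleMap 0 r t • v) := by
    intro x hx
    refine hk_cont.smul (continuous_iff_continuousAt.2 fun t => ?_)
    exact ContinuousAt.comp (f := fun t : ℝ => x + circleMap 0 r t • v)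
      (hdiff _ (hlarge (hmem x hx _ (hcm t)))).continuousAt (by fun_prop)
  have hnhds : Metric.ball x₀ (ε / 4) ∈ 𝓝 x₀ := Metric.ball_mem_nhds _ (by positivity)
  have key := intervalIntegral.hasFDerivAt_integral_of_dominated_of_fderiv_le
    (𝕜 := ℂ) (μ := MeasureTheory.volume) (a := 0) (b := 2 * Real.pi)
    (F := fun x (t : ℝ) => k t • F (x + circleMap 0 r t • v))
    (F' := fun x (t : ℝ) => k t • fderiv ℂ F (x + circleMap 0 r t • v))
    (bound := fun t => ‖k t‖ * (2 / (ε / 2))) hnhds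
    (by filter_upwards [hnhds] with x hx using (hF_cont x hx).aestronglyMeasurable)
    ((hF_cont x₀ (mem_of_mem_nhds hnhds)).intervalIntegrable _ _)
    (by
      borelize E
      have : ProperSpace E := FiniteDimensional.proper ℂ E
      have hm : Measurable fun t : ℝ => fderiv ℂ F (x₀ + circleMap 0 r t • v) :=
        (measurable_fderiv ℂ F).comp
          (Continuous.measurable (f := fun t : ℝ => x₀ + circleMap 0 r t • v) (by fun_prop))
      have : ProperSpace (E →L[ℂ] ℂ) := FiniteDimensional.proper ℂ _
      exact hk_cont.aestronglyMeasurable.smul hm.aestronglyMeasurable)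
    (Eventually.of_forall fun t _ x hx => by
      rw [norm_smul]
      gcongr
      exact hbound _ (hmem x hx _ (hcm t)))
    (Continuous.intervalIntegrable (by fun_prop) _ _)
    (Eventually.of_forall fun t _ x hx => by
      have h1 := (hdiff _ (hlarge (hmem x hx _ (hcm t)))).hasFDerivAt
      have h2 : HasFDerivAt (fun x : E => x + circleMap 0 r t • v) (ContinuousLinearMap.id ℂ E) x :=
        (hasFDerivAt_id x).add_const _
      exact (h1.comp x h2).const_smul (k t))
  refine ((key.differentiableAt.const_smul (2 * Real.pi * I : ℂ)⁻¹)).congr_of_eventuallyEq ?_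
  filter_upwards [hnhds] with x hx
  rw [← hcauchy x hx, cderiv, circleIntegral]
  simp [hk, mul_assoc]

theorem holomorphic_differentiableAt_fderiv {E : Type*} [NormedAddCommGroup E]
    [NormedSpace ℂ E] [FiniteDimensional ℂ E] {F : E → ℂ} {S : Set E} (hS : IsOpen S)
    (hF : DifferentiableOn ℂ F S) {x₀ : E} (hx₀ : x₀ ∈ S) :
    DifferentiableAt ℂ (fderiv ℂ F) x₀ := by
  let b := Module.finBasis ℂ E
  have h : fderiv ℂ F = fun x => ∑ i, fderiv ℂ F x (b i) • (b.coord i).toContinuousLinearMap := by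
    ext x w
    conv_lhs => rw [← b.sum_repr w, map_sum]
    simp [mul_comm]
  rw [h]
  exact DifferentiableAt.fun_sum fun i _ =>
    (holomorphic_differentiableAt_fderiv_apply hS hF hx₀ (b i)).smul_const _

theorem holomorphic_fderiv_fderiv_apply_comm {E : Type*} [NormedAddCommGroup E]
    [NormedSpace ℂ E] [FiniteDimensional ℂ E] {F : E → ℂ} {S : Set E} (hS : IsOpen S)
    (hF : DifferentiableOn ℂ F S) {x : E} (hx : x ∈ S) (u v : E) :
    fderiv ℂ (fun y => fderiv ℂ F y v) x u = fderiv ℂ (fun y => fderiv ℂ F y u) x v := by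
  have hd := holomorphic_differentiableAt_fderiv hS hF hx
  have h : ∀ w, fderiv ℂ (fun y => fderiv ℂ F y w) x = (fderiv ℂ (fderiv ℂ F) x).flip w := by
    intro w
    rw [fderiv_clm_apply hd (differentiableAt_const _)]
    simp
  rw [h, h]
  refine second_derivative_symmetric_of_eventually (f := F) ?_ hd.hasFDerivAt u v
  filter_upwards [hS.mem_nhds hx] with y hy using (hF.differentiableAt (hS.mem_nhds hy)).hasFDerivAt

theorem fderiv_partial_left {E₁ E₂ : Type*} [NormedAddCommGroup E₁] [NormedSpace ℂ E₁]
    [NormedAddCommGroup E₂] [NormedSpace ℂ E₂] {F : E₁ × E₂ → ℂ} {x : E₁} {y : E₂}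
    (hF : DifferentiableAt ℂ F (x, y)) (u : E₁) :
    fderiv ℂ (fun x' => F (x', y)) x u = fderiv ℂ F (x, y) (u, 0) := by
  have h : HasFDerivAt (fun x' => F (x', y)) _ x :=
    hF.hasFDerivAt.comp x (hasFDerivAt_prodMk_left x y)
  rw [h.fderiv]
  simp

theorem fderiv_partial_right {E₁ E₂ : Type*} [NormedAddCommGroup E₁] [NormedSpace ℂ E₁]
    [NormedAddCommGroup E₂] [NormedSpace ℂ E₂] {F : E₁ × E₂ → ℂ} {x : E₁} {y : E₂}
    (hF : DifferentiableAt ℂ F (x, y)) (v : E₂) :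
    fderiv ℂ (fun y' => F (x, y')) y v = fderiv ℂ F (x, y) (0, v) := by
  have h : HasFDerivAt (fun y' => F (x, y')) _ y :=
    hF.hasFDerivAt.comp y (hasFDerivAt_prodMk_right x y)
  rw [h.fderiv]
  simp

theorem wderiv_congr {n : ℕ} {f g : (Fin n → ℂ) → ℂ} {z : Fin n → ℂ} (h : f =ᶠ[𝓝 z] g)
    (j : Fin n) : wderiv j f z = wderiv j g z := by
  simp only [wderiv, h.fderiv_eq]

theorem wderivBar_congr {n : ℕ} {f g : (Fin n → ℂ) → ℂ} {z : Fin n → ℂ} (h : f =ᶠ[𝓝 z] g)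
    (j : Fin n) : wderivBar j f z = wderivBar j g z := by
  simp only [wderivBar, h.fderiv_eq]

theorem fderiv_diagonal {n : ℕ} {F : (Fin n → ℂ) × (Fin n → ℂ) → ℂ} {z : Fin n → ℂ}
    (hF : DifferentiableAt ℂ F (z, star z)) (j : Fin n) (c : ℂ) :
    fderiv ℝ (fun z => F (z, star z)) z (Pi.single j c) =
      c * fderiv ℂ F (z, star z) (Pi.single j 1, 0) +
        star c * fderiv ℂ F (z, star z) (0, Pi.single j 1) := by
  have h1 : HasFDerivAt (fun z : Fin n → ℂ => (z, star z))
      ((ContinuousLinearMap.id ℝ (Fin n → ℂ)).prod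
        (starL' ℝ : (Fin n → ℂ) ≃L[ℝ] (Fin n → ℂ)).toContinuousLinearMap) z :=
    (hasFDerivAt_id z).prodMk (starL' ℝ : (Fin n → ℂ) ≃L[ℝ] (Fin n → ℂ)).hasFDerivAt
  have h2 := (hF.hasFDerivAt.restrictScalars ℝ).comp z h1
  have h3 : ((Pi.single j c : Fin n → ℂ), star (Pi.single j c : Fin n → ℂ)) =
      c • ((Pi.single j 1 : Fin n → ℂ), (0 : Fin n → ℂ)) +
        star c • ((0 : Fin n → ℂ), (Pi.single j 1 : Fin n → ℂ)) := by
    ext i <;> by_cases h : i = j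
    · subst h; simp
    · simp [h]
    · subst h; simp
    · simp [h]
  calc fderiv ℝ (fun z => F (z, star z)) z (Pi.single j c)
      = fderiv ℂ F (z, star z) (Pi.single j c, star (Pi.single j c)) := by
        rw [show (fun z => F (z, star z)) = F ∘ fun z => (z, star z) from rfl, h2.fderiv]
        rfl
    _ = _ := by rw [h3, map_add, map_smul, map_smul, smul_eq_mul, smul_eq_mul]

theorem wderiv_diagonal {n : ℕ} {F : (Fin n → ℂ) × (Fin n → ℂ) → ℂ} {z : Fin n → ℂ}
    (hF : DifferentiableAt ℂ F (z, star z)) (j : Fin n) :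
    wderiv j (fun z => F (z, star z)) z = fderiv ℂ F (z, star z) (Pi.single j 1, 0) := by
  rw [wderiv, fderiv_diagonal hF, fderiv_diagonal hF]
  simp only [star_one, Complex.star_def, Complex.conj_I]
  ring_nf
  rw [Complex.I_sq]
  ring

theorem wderivBar_diagonal {n : ℕ} {F : (Fin n → ℂ) × (Fin n → ℂ) → ℂ} {z : Fin n → ℂ}
    (hF : DifferentiableAt ℂ F (z, star z)) (j : Fin n) :
    wderivBar j (fun z => F (z, star z)) z = fderiv ℂ F (z, star z) (0, Pi.single j 1) := by
  rw [wderivBar, fderiv_diagonal hF, fderiv_diagonal hF]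
  simp only [star_one, Complex.star_def, Complex.conj_I]
  ring_nf
  rw [Complex.I_sq]
  ring

theorem hasFDerivAt_bilinear {n : ℕ} (c d w : Fin n → ℂ) :
    HasFDerivAt (fun w : Fin n → ℂ => ∑ j, c j * (w j - d j))
      (∑ j, c j • (ContinuousLinearMap.proj j : (Fin n → ℂ) →L[ℂ] ℂ)) w :=
  HasFDerivAt.fun_sum fun j _ => ((hasFDerivAt_apply j w).sub_const (d j)).const_mul (c j)

theorem fderiv_apply_single_of_fderiv_sub_eq_zero {n : ℕ} {f : (Fin n → ℂ) → ℂ}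
    {c d w : Fin n → ℂ} (hf : DifferentiableAt ℂ f w)
    (h : fderiv ℂ (fun w => f w - ∑ j, c j * (w j - d j)) w = 0) (b : Fin n) :
    fderiv ℂ f w (Pi.single b 1) = c b := by
  rw [(hf.hasFDerivAt.fun_sub (hasFDerivAt_bilinear c d w)).fderiv, sub_eq_zero] at h
  rw [h]
  simp [Pi.single_apply]

theorem fderiv_coord_sub_single {n : ℕ} {f : (Fin n → ℂ) → ℂ} {s : Set (Fin n → ℂ)}
    (hs : IsOpen s) {z d : Fin n → ℂ} (hz : z ∈ s) {b : Fin n}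
    (h : ∀ y ∈ s, f y = y b - d b) (a : Fin n) :
    fderiv ℂ f z (Pi.single a 1) = (1 : Matrix (Fin n) (Fin n) ℂ) a b := by
  have he : f =ᶠ[𝓝 z] fun y => y b - d b := by
    filter_upwards [hs.mem_nhds hz] with y hy using h y hy
  rw [he.fderiv_eq, ((hasFDerivAt_apply b z).sub_const (d b)).fderiv]
  simp [Matrix.one_apply, Pi.single_apply, eq_comm]

theorem DifferentiableAt.matrix_det {E : Type*} [NormedAddCommGroup E] [NormedSpace ℂ E]
    {n : ℕ} {M : E → Matrix (Fin n) (Fin n) ℂ} {x : E}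
    (hM : ∀ a b, DifferentiableAt ℂ (fun y => M y a b) x) :
    DifferentiableAt ℂ (fun y => (M y).det) x := by
  simp only [Matrix.det_apply]
  exact DifferentiableAt.fun_sum fun σ _ =>
    (HasFDerivAt.finsetProd fun i _ => (hM (σ i) i).hasFDerivAt).differentiableAt.const_smul _

/-- If a real-analytic (real-valued) function `D` is in Bochner form at `p`, then
`det[∂²D/∂z_a ∂z̄_b]` is of diastasis-type at `p`. -/
theorem stmt6 {n : ℕ} (p : Fin n → ℂ) (D : (Fin n → ℂ) → ℂ)
    (hreal : ∀ᶠ z in 𝓝 p, (D z).im = 0)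
    (hBochner : IsBochnerAt D p) :
    IsDiastasisTypeAt
      (fun z => Matrix.det (Matrix.of fun a b : Fin n => wderiv a (wderivBar b D) z)) p := by
  obtain ⟨E, U, V, hU, hV, hpU, hpV, hE, hDE, hz, hw⟩ := hBochner
  set F : (Fin n → ℂ) × (Fin n → ℂ) → ℂ := fun q => E q.1 q.2
  set G : Fin n → (Fin n → ℂ) × (Fin n → ℂ) → ℂ :=
    fun b q => fderiv ℂ F q (0, Pi.single b 1)
  set H : Fin n → Fin n → (Fin n → ℂ) × (Fin n → ℂ) → ℂ :=
    fun a b q => fderiv ℂ (G b) q (Pi.single a 1, 0)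
  have hUV : IsOpen (U ×ˢ V) := hU.prod hV
  have hFd : ∀ q ∈ U ×ˢ V, DifferentiableAt ℂ F q := fun q hq =>
    hE.differentiableAt (hUV.mem_nhds hq)
  have hfd : ∀ v, ∀ q ∈ U ×ˢ V, DifferentiableAt ℂ (fun q => fderiv ℂ F q v) q := fun v q hq =>
    holomorphic_differentiableAt_fderiv_apply hUV hE hq v
  have hGd : ∀ b, ∀ q ∈ U ×ˢ V, DifferentiableAt ℂ (G b) q := fun b => hfd _
  have hHd : ∀ a b, ∀ q ∈ U ×ˢ V, DifferentiableAt ℂ (H a b) q := fun a b q hq =>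
    holomorphic_differentiableAt_fderiv_apply hUV
      (fun q hq => (hGd b q hq).differentiableWithinAt) hq _
  have hH_right : ∀ z ∈ U, ∀ a b, H a b (z, star p) = (1 : Matrix (Fin n) (Fin n) ℂ) a b := by
    intro z hzU a b
    change fderiv ℂ (G b) (z, star p) (Pi.single a 1, 0) = _
    rw [← fderiv_partial_left (hGd b _ ⟨hzU, hpV⟩)]
    refine fderiv_coord_sub_single hU (d := p) hzU (fun y hy => ?_) a
    have hd : DifferentiableAt ℂ (fun w => F (y, w)) (star p) :=
      (hFd (y, star p) ⟨hy, hpV⟩).comp (f := fun w => (y, w)) (star p) (by fun_prop)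
    change fderiv ℂ F (y, star p) (0, Pi.single b 1) = _
    rw [← fderiv_partial_right (hFd (y, star p) ⟨hy, hpV⟩)]
    exact fderiv_apply_single_of_fderiv_sub_eq_zero (c := fun j => y j - p j) (d := star p) hd
      (hw y hy).2 b
  have hH_left : ∀ w ∈ V, ∀ a b, H a b (p, w) = (1 : Matrix (Fin n) (Fin n) ℂ) a b := by
    intro w hwV a b
    change fderiv ℂ (fun q => fderiv ℂ F q (0, Pi.single b 1)) (p, w) (Pi.single a 1, 0) = _
    rw [holomorphic_fderiv_fderiv_apply_comm hUV hE ⟨hpU, hwV⟩,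
      ← fderiv_partial_right (hfd _ _ ⟨hpU, hwV⟩), ← Matrix.transpose_one, Matrix.transpose_apply]
    refine fderiv_coord_sub_single hV (d := star p) hwV (fun y hy => ?_) b
    have hd : DifferentiableAt ℂ (fun z => F (z, y)) p :=
      (hFd (p, y) ⟨hpU, hy⟩).comp (f := fun z => (z, y)) p (by fun_prop)
    rw [← fderiv_partial_left (hFd (p, y) ⟨hpU, hy⟩)]
    refine fderiv_apply_single_of_fderiv_sub_eq_zero (c := fun j => y j - star p j) (d := p) hd
      ?_ a
    refine Eq.trans ?_ (hz y hy).2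
    congr 1
    ext z
    simp [F, mul_comm]
  refine ⟨fun z w => Matrix.det (Matrix.of fun a b => H a b (z, w)), U, V, hU, hV, hpU, hpV,
    fun q hq => (DifferentiableAt.matrix_det fun a b => hHd a b q hq).differentiableWithinAt,
    ?_, fun z hzU => ?_, fun w hwV => ?_⟩
  · have hnear : ∀ᶠ z in 𝓝 p, (z, star z) ∈ U ×ˢ V :=
      ContinuousAt.eventually_mem (f := fun z : Fin n → ℂ => (z, star z)) (by fun_prop)
        (hUV.mem_nhds ⟨hpU, hpV⟩)
    have hbar : ∀ᶠ z in 𝓝 p, ∀ b, wderivBar b D z = G b (z, star z) := by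
      filter_upwards [hDE.eventually_nhds, hnear] with z hDz hzUV b
      rw [wderivBar_congr (g := fun z => F (z, star z)) hDz, wderivBar_diagonal (hFd _ hzUV)]
    filter_upwards [hbar.eventually_nhds, hnear] with z hbz hzUV
    congr 2
    ext a b
    rw [wderiv_congr (g := fun z => G b (z, star z)) (hbz.mono fun y hy => hy b),
      wderiv_diagonal (hGd b _ hzUV)]
  · simp only [hH_right z hzU, hH_right p hpU]
  · simp only [hH_left w hwV, hH_left _ hpV]
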